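/- With A := 1 + (γ/2)(α(1) σ₁⊗σ₃ + α(0) σ₂⊗σ₂) as above for e ∈ (-1,1), γ ∈ ℝ, suppose det(A) ≠ 0. Then A⁻¹ = (1/det A)(β₁ 1 + β₂ σ₃⊗σ₁ + β₃ σ₁⊗σ₃ + β₄ σ₂⊗σ₂), where, writing w := e + i√(1-e²), β₁ = 1 + (γ²/2) e w/(1-e²), β₂ = -(γ²/2) w/(1-e²), β₃ = i(γ/2)(w/√(1-e²))(1 + i(γ²/2) w/√(1-e²)), β₄ = i(γ/2)(1/√(1-e²))(1 - i(γ²/2) w/√(1-e²)). -/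

import Mathlib

open Matrix Kronecker Complex

/-- Pauli matrix σ₁. -/
noncomputable def pauli1 : Matrix (Fin 2) (Fin 2) ℂ := !![0, 1; 1, 0]
/-- Pauli matrix σ₂. -/
noncomputable def pauli2 : Matrix (Fin 2) (Fin 2) ℂ := !![0, -Complex.I; Complex.I, 0]
/-- Pauli matrix σ₃. -/
noncomputable def pauli3 : Matrix (Fin 2) (Fin 2) ℂ := !![1, 0; 0, -1]

/-- Boundary value resolvent kernel `α(x) = -i w^{|x|}/√(1-e²)` with `w = e+i√(1-e²)`. -/
noncomputable def alphaBV (e : ℝ) (x : ℤ) : ℂ :=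
  -Complex.I * ((e : ℂ) + Complex.I * (Real.sqrt (1 - e ^ 2) : ℝ)) ^ x.natAbs /
    (Real.sqrt (1 - e ^ 2) : ℝ)

/-- The limiting interaction matrix `A_{γ,e-i0}`. -/
noncomputable def interactionMatrix (γ e : ℝ) : Matrix (Fin 2 × Fin 2) (Fin 2 × Fin 2) ℂ :=
  1 + (γ / 2 : ℂ) • (alphaBV e 1 • (pauli1 ⊗ₖ pauli3) + alphaBV e 0 • (pauli2 ⊗ₖ pauli2))

lemma aux_det (a b : ℂ) :
    (1 + (a • (pauli1 ⊗ₖ pauli3) + b • (pauli2 ⊗ₖ pauli2)) :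
      Matrix (Fin 2 × Fin 2) (Fin 2 × Fin 2) ℂ).det = (1 + a ^ 2 - b ^ 2) ^ 2 - 4 * a ^ 2 := by
  rw [← Matrix.det_submatrix_equiv_self (finProdFinEquiv (m := 2) (n := 2)).symm]
  have h : (1 + (a • (pauli1 ⊗ₖ pauli3) + b • (pauli2 ⊗ₖ pauli2)) :
      Matrix (Fin 2 × Fin 2) (Fin 2 × Fin 2) ℂ).submatrix
        (finProdFinEquiv (m := 2) (n := 2)).symm (finProdFinEquiv (m := 2) (n := 2)).symm
      = (!![1, 0, a, -b; 0, 1, b, -a; a, b, 1, 0; -b, -a, 0, 1] : Matrix (Fin 4) (Fin 4) ℂ) := by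
    ext i j
    fin_cases i <;> fin_cases j <;>
      simp [pauli1, pauli2, pauli3, finProdFinEquiv, Fin.divNat, Fin.modNat, Matrix.one_apply]
  refine (congrArg Matrix.det h).trans ?_
  simp [Matrix.det_succ_row_zero, Fin.sum_univ_succ, Fin.succAbove]
  ring

lemma aux_mul (a b : ℂ) :
    (1 + (a • (pauli1 ⊗ₖ pauli3) + b • (pauli2 ⊗ₖ pauli2)) :
      Matrix (Fin 2 × Fin 2) (Fin 2 × Fin 2) ℂ) *
     ((1 - a ^ 2 - b ^ 2) • (1 : Matrix (Fin 2 × Fin 2) (Fin 2 × Fin 2) ℂ)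
      + (2 * a * b) • (pauli3 ⊗ₖ pauli1)
      + (a * (a ^ 2 - b ^ 2 - 1)) • (pauli1 ⊗ₖ pauli3)
      + (-b * (1 + a ^ 2 - b ^ 2)) • (pauli2 ⊗ₖ pauli2))
      = ((1 + a ^ 2 - b ^ 2) ^ 2 - 4 * a ^ 2) • 1 := by
  ext ⟨i, k⟩ ⟨j, l⟩
  fin_cases i <;> fin_cases j <;> fin_cases k <;> fin_cases l <;>
    simp [pauli1, pauli2, pauli3, Matrix.mul_apply, Fintype.sum_prod_type, Matrix.one_apply] <;>
    ring

theorem inv_interactionMatrix (γ e : ℝ) (he : e ∈ Set.Ioo (-1 : ℝ) 1)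
    (hdet : (interactionMatrix γ e).det ≠ 0) :
    (interactionMatrix γ e)⁻¹
      = ((interactionMatrix γ e).det)⁻¹ •
          (((1 : ℂ) + (γ : ℂ) ^ 2 / 2 * ((e : ℂ) * ((e : ℂ) + Complex.I * (Real.sqrt (1 - e ^ 2) : ℝ)))
              / ((1 : ℂ) - (e : ℂ) ^ 2)) • (1 : Matrix (Fin 2 × Fin 2) (Fin 2 × Fin 2) ℂ)
          + (-((γ : ℂ) ^ 2 / 2) * (((e : ℂ) + Complex.I * (Real.sqrt (1 - e ^ 2) : ℝ))
              / ((1 : ℂ) - (e : ℂ) ^ 2))) • (pauli3 ⊗ₖ pauli1)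
          + (Complex.I * ((γ : ℂ) / 2) * (((e : ℂ) + Complex.I * (Real.sqrt (1 - e ^ 2) : ℝ))
              / (Real.sqrt (1 - e ^ 2) : ℝ)) *
              ((1 : ℂ) + Complex.I * ((γ : ℂ) ^ 2 / 2) *
                (((e : ℂ) + Complex.I * (Real.sqrt (1 - e ^ 2) : ℝ)) / (Real.sqrt (1 - e ^ 2) : ℝ))))
              • (pauli1 ⊗ₖ pauli3)
          + (Complex.I * ((γ : ℂ) / 2) * ((1 : ℂ) / (Real.sqrt (1 - e ^ 2) : ℝ)) *
              ((1 : ℂ) - Complex.I * ((γ : ℂ) ^ 2 / 2) *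
                (((e : ℂ) + Complex.I * (Real.sqrt (1 - e ^ 2) : ℝ)) / (Real.sqrt (1 - e ^ 2) : ℝ))))
              • (pauli2 ⊗ₖ pauli2)) := by
  obtain ⟨h1, h2⟩ := he
  have hpos : 0 < 1 - e ^ 2 := by nlinarith
  have hs0 : ((Real.sqrt (1 - e ^ 2) : ℝ) : ℂ) ≠ 0 := by
    exact_mod_cast (Real.sqrt_pos.mpr hpos).ne'
  have hs2 : ((Real.sqrt (1 - e ^ 2) : ℝ) : ℂ) ^ 2 = 1 - (e : ℂ) ^ 2 := by
    exact_mod_cast Real.sq_sqrt hpos.le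
  have hA : interactionMatrix γ e = 1 + ((γ / 2 * alphaBV e 1 : ℂ) • (pauli1 ⊗ₖ pauli3)
      + (γ / 2 * alphaBV e 0 : ℂ) • (pauli2 ⊗ₖ pauli2)) := by
    simp only [interactionMatrix, smul_add, smul_smul]
  have ha : alphaBV e 1 = -Complex.I * ((e : ℂ) + Complex.I * (Real.sqrt (1 - e ^ 2) : ℝ)) /
    (Real.sqrt (1 - e ^ 2) : ℝ) := by simp [alphaBV]
  have hb : alphaBV e 0 = -Complex.I / (Real.sqrt (1 - e ^ 2) : ℝ) := by simp [alphaBV]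
  apply Matrix.inv_eq_right_inv
  rw [Matrix.mul_smul, inv_smul_eq_iff₀ hdet]
  rw [hA, aux_det, ← aux_mul]
  rw [ha, hb, ← hs2]
  have he2 : (e : ℂ) ^ 2 = 1 - ((Real.sqrt (1 - e ^ 2) : ℝ) : ℂ) ^ 2 := by rw [hs2]; ring
  generalize ((Real.sqrt (1 - e ^ 2) : ℝ) : ℂ) = s at *
  have hI := Complex.I_sq
  congr 1
  congr 1
  · congr 1
    · congr 1
      · congr 1
        field_simp
        grind
      · congr 1
        field_simp
        grind
    · congr 1
      field_simp
      grind
  · congr 1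
    field_simp
    grind
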